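/- arXiv:2509.26052 — 3 statements merged into one kernel-verified Lean document; each statement's English description precedes it below -/
import Mathlib

section
/- If C and C′ are Lagrangian submodules of (ZMod N)^{2g} with respect to η (N ≥ 1, g ≥ 1) that are isomorphic as additive groups, then there exists a 2g×2g matrix γ over ZMod N with γ·η·γᵀ = η (i.e. γ ∈ Sp(2g, ZMod N)) such that C′ is the image of C under right multiplication by γ, i.e. C′ = {v·γ : v ∈ C}. In other words, Lagrangian submodules that are isomorphic as groups belong to the same symplectic orbit. -/
open Matrix

/-- The symplectic form `η` on `(ZMod N)^{2g}`:
`η(x,y) = ∑_{i=1}^g (x_{g+i} y_i − x_i y_{g+i})`. -/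
def etaForm (N g : ℕ) (x y : Fin (2 * g) → ZMod N) : ZMod N :=
  ∑ i : Fin g,
    (x ⟨g + i.1, by have := i.2; omega⟩ * y ⟨i.1, by have := i.2; omega⟩ -
      x ⟨i.1, by have := i.2; omega⟩ * y ⟨g + i.1, by have := i.2; omega⟩)

/-- The block matrix `[[0, -I_g],[I_g, 0]]` of `η`, over `ZMod N`. -/
def etaMat (N g : ℕ) : Matrix (Fin (2 * g)) (Fin (2 * g)) (ZMod N) :=
  Matrix.of fun i j => if j.1 = i.1 + g then -1 else if i.1 = j.1 + g then 1 else 0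

/-- Multiplication by `m` on `ZMod (d * m)` has kernel generated by `d`. -/
theorem ZMod.exists_eq_nsmul_of_nsmul_eq_zero {N d m : ℕ} [NeZero N] (h : d * m = N)
    {a : ZMod N} (ha : m • a = 0) : ∃ r : ZMod N, a = d • r := by
  have hm : 0 < m := Nat.pos_of_ne_zero fun h0 => NeZero.ne N (by simp [← h, h0])
  have hdvd : N ∣ m * a.val := by
    rw [← ZMod.natCast_eq_zero_iff, Nat.cast_mul, ZMod.natCast_rightInverse a, ← nsmul_eq_mul, ha]
  obtain ⟨r, hr⟩ : d ∣ a.val :=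
    Nat.dvd_of_mul_dvd_mul_left hm (((mul_comm m d).trans h).dvd.trans hdvd)
  exact ⟨r, by rw [← ZMod.natCast_rightInverse a, hr, nsmul_eq_mul, Nat.cast_mul]⟩

/-- In a finite monoid every element has a positive power that is idempotent. -/
theorem exists_pow_isIdempotentElem {M : Type*} [Monoid M] [Finite M] (a : M) :
    ∃ n, n ≠ 0 ∧ IsIdempotentElem (a ^ n) := by
  obtain ⟨i, j, hij, h⟩ : ∃ i j : ℕ, i < j ∧ a ^ i = a ^ j := by
    obtain ⟨i, j, hne, h⟩ := Finite.exists_ne_map_eq_of_infinite (fun n : ℕ => a ^ n)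
    rcases lt_or_gt_of_ne hne with hlt | hlt
    exacts [⟨i, j, hlt, h⟩, ⟨j, i, hlt, h.symm⟩]
  obtain ⟨k, rfl⟩ := Nat.exists_eq_add_of_lt hij
  have hper : ∀ t n, i ≤ n → a ^ (n + (k + 1) * t) = a ^ n := by
    intro t
    induction t with
    | zero => simp
    | succ t ih =>
      intro n hn
      rw [← ih n hn]
      obtain ⟨c, rfl⟩ := Nat.exists_eq_add_of_le hn
      rw [show i + c + (k + 1) * (t + 1) = (i + k + 1) + (c + (k + 1) * t) by ring,
        pow_add, ← h, ← pow_add, add_assoc]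
  refine ⟨(k + 1) * (i + 1), by positivity, ?_⟩
  rw [IsIdempotentElem, ← pow_add]
  exact hper _ _ (by nlinarith)

theorem Nat.card_nsmul_eq_zero_prod (A B : Type*) [AddCommGroup A] [AddCommGroup B] (k : ℕ) :
    Nat.card {x : A × B // k • x = 0} =
      Nat.card {a : A // k • a = 0} * Nat.card {b : B // k • b = 0} := by
  rw [← Nat.card_prod]
  exact Nat.card_congr ((Equiv.subtypeEquivRight fun x => by simp [Prod.ext_iff]).trans
    (Equiv.subtypeProdEquivProd (p := fun a : A => k • a = 0) (q := fun b : B => k • b = 0)))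

/-- The exponent of a finite abelian group is visible in the orders of its torsion subgroups. -/
theorem forall_nsmul_eq_zero_iff_card {A : Type*} [AddCommGroup A] [Finite A] (k : ℕ) :
    (∀ a : A, k • a = 0) ↔ Nat.card {a : A // k • a = 0} = Nat.card {a : A // 0 • a = 0} := by
  have h0 : Nat.card {a : A // 0 • a = 0} = Nat.card A :=
    Nat.card_congr (Equiv.subtypeUnivEquiv fun a => zero_nsmul a)
  rw [h0]
  constructor
  · intro h
    exact Nat.card_congr (Equiv.subtypeUnivEquiv h)
  · intro h a
    have := (Nat.bijective_iff_injective_and_card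
      (Subtype.val : {a : A // k • a = 0} → A)).2 ⟨Subtype.val_injective, h⟩
    obtain ⟨b, rfl⟩ := this.2 a
    exact b.2

/-- A nondegenerate alternating form on a finite `ZMod N`-module which has the torsion of a
free module of rank `2 * g`. -/
structure IsSymplecticForm (N g : ℕ) {V : Type*} [AddCommGroup V] [Module (ZMod N) V]
    (ω : V →ₗ[ZMod N] V →ₗ[ZMod N] ZMod N) : Prop where
  alt : ∀ x, ω x x = 0
  nondegenerate : ∀ x, (∀ y, ω x y = 0) → x = 0
  divisible : ∀ d m : ℕ, d * m = N → ∀ x : V, m • x = 0 → ∃ y : V, x = d • y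
  card_torsion : ∀ k : ℕ,
    Nat.card {x : V // k • x = 0} = Nat.card {a : ZMod N // k • a = 0} ^ (2 * g)

section

variable {N : ℕ} {V : Type*} [AddCommGroup V] [Module (ZMod N) V]
  (ω : V →ₗ[ZMod N] V →ₗ[ZMod N] ZMod N)

theorem neg_eq_of_alt (alt : ∀ x, ω x x = 0) (x y : V) : ω y x = -ω x y := by
  have h := alt (x + y)
  simp only [map_add, LinearMap.add_apply, alt, zero_add, add_zero] at h
  exact eq_neg_of_add_eq_zero_left h

theorem nsmul_eq_zero_of_zmod (x : V) : N • x = 0 := by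
  rw [← Nat.cast_smul_eq_nsmul (ZMod N), ZMod.natCast_self, zero_smul]

/-- If `x` has order `m`, the functional `ω x` takes the value `N / m`. -/
theorem exists_apply_eq_of_addOrderOf [NeZero N]
    (nondeg : ∀ x, (∀ y, ω x y = 0) → x = 0) {d m : ℕ} (h : d * m = N) {x : V}
    (hx : addOrderOf x = m) : ∃ y, ω x y = d := by
  obtain ⟨⟨_, y, rfl⟩, hr⟩ := AddMonoid.exists_addOrderOf_eq_exponent
    (AddMonoid.ExponentExists.of_finite (G := LinearMap.range (ω x)))
  set r := ω x y with hrdef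
  set k := AddMonoid.exponent (LinearMap.range (ω x))
  have hk : addOrderOf r = k := by 
    rw [← hr]
    exact addOrderOf_injective (LinearMap.range (ω x)).subtype.toAddMonoidHom
      Subtype.val_injective ⟨r, y, rfl⟩
  have hkx : k • x = 0 := nondeg _ fun z => by
    have := AddMonoid.exponent_nsmul_eq_zero (⟨ω x z, z, rfl⟩ : LinearMap.range (ω x))
    simpa using congrArg Subtype.val this
  obtain ⟨q, hq⟩ : m ∣ k := hx ▸ addOrderOf_dvd_of_nsmul_eq_zero hkx
  have hgk : Nat.gcd r.val N * k = N := by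
    rw [← hk, ← ZMod.natCast_rightInverse r, ZMod.addOrderOf_coe _ (NeZero.ne N),
      ZMod.natCast_rightInverse r, Nat.gcd_comm, Nat.mul_div_cancel' (Nat.gcd_dvd_left _ _)]
  have hm : m ≠ 0 := fun h0 => NeZero.ne N (by simp [← h, h0])
  have hd : d = Nat.gcd r.val N * q := by
    apply mul_right_cancel₀ hm
    rw [h, mul_assoc, mul_comm q m, ← hq, hgk]
  refine ⟨((q : ZMod N) * r⁻¹) • y, ?_⟩
  rw [map_smul, ← hrdef, smul_eq_mul, mul_assoc, mul_comm r⁻¹, ZMod.mul_inv_eq_gcd, hd,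
    Nat.cast_mul, mul_comm]

/-- An element of order `m` is `N / m` times a member of a hyperbolic pair. -/
theorem IsSymplecticForm.exists_hyperbolic_pair [NeZero N] [Finite V] {g : ℕ} {ω}
    (hω : IsSymplecticForm N (g + 1) ω) {d m : ℕ} (h : d * m = N) {x : V}
    (hx : addOrderOf x = m) : ∃ e f, ω e f = 1 ∧ d • e = x := by
  have hmx : m • x = 0 := hx ▸ addOrderOf_nsmul_eq_zero x
  obtain ⟨w, z, hwz⟩ : ∃ w z, ω w z = 1 := by
    obtain ⟨w, hw⟩ := AddMonoid.exists_addOrderOf_eq_exponent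
      (AddMonoid.ExponentExists.of_finite (G := V))
    have hV := (forall_nsmul_eq_zero_iff_card (A := V) _).1
      AddMonoid.exponent_nsmul_eq_zero
    rw [hω.card_torsion, hω.card_torsion] at hV
    have hR := (forall_nsmul_eq_zero_iff_card (A := ZMod N) _).2
      (Nat.pow_left_injective (by omega) hV) 1
    rw [nsmul_one, ZMod.natCast_eq_zero_iff, ← hw] at hR
    have hw' : addOrderOf w = N :=
      Nat.dvd_antisymm (addOrderOf_dvd_of_nsmul_eq_zero (nsmul_eq_zero_of_zmod w)) hR
    obtain ⟨z, hz⟩ := exists_apply_eq_of_addOrderOf ω hω.nondegenerate (one_mul N) hw'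
    exact ⟨w, z, by simpa using hz⟩
  obtain ⟨e₀, rfl⟩ := hω.divisible d m h x hmx
  obtain ⟨f₀, hf₀⟩ := exists_apply_eq_of_addOrderOf ω hω.nondegenerate h hx
  obtain ⟨t, ht⟩ : ∃ t : ZMod N, ω e₀ f₀ - 1 = m • t := by
    apply ZMod.exists_eq_nsmul_of_nsmul_eq_zero ((mul_comm m d).trans h)
    rw [map_nsmul, LinearMap.smul_apply] at hf₀
    rw [nsmul_sub, hf₀, nsmul_one, sub_self]
  obtain ⟨n, hn0, hn⟩ := exists_pow_isIdempotentElem (m : ZMod N)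
  set ε := (m : ZMod N) ^ n with hε
  have hdm : (d : ZMod N) * m = 0 := by rw [← Nat.cast_mul, h, ZMod.natCast_self]
  have hdε : (d : ZMod N) * ε = 0 := by
    rw [hε, ← Nat.succ_pred_eq_of_ne_zero hn0, pow_succ', ← mul_assoc, hdm, zero_mul]
  have hunit : IsUnit (1 + (1 - ε) * m * t) := by
    apply IsNilpotent.isUnit_one_add
    refine ⟨n, ?_⟩
    rw [mul_pow, mul_pow, hn.one_sub.pow_eq hn0, ← hε, sub_mul, one_mul, hn.eq, sub_self, zero_mul]
  have hval : ω ((1 - ε) • e₀ + ε • w) ((1 - ε) • f₀ + ε • z) = 1 + (1 - ε) * m * t := by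
    have h1 : ω e₀ f₀ = 1 + m * t := by rw [← nsmul_eq_mul, ← ht]; ring
    simp only [map_add, map_smul, LinearMap.add_apply, LinearMap.smul_apply, smul_eq_mul, h1, hwz]
    have := hn.eq
    linear_combination (ω e₀ z * (-1) - ω w f₀ + 2 + m * t) * this
  obtain ⟨u, hu⟩ := hunit
  refine ⟨(1 - ε) • e₀ + ε • w, (↑u⁻¹ : ZMod N) • ((1 - ε) • f₀ + ε • z), ?_, ?_⟩
  · rw [map_smul, hval, ← hu, smul_eq_mul, Units.inv_mul]
  · rw [← Nat.cast_smul_eq_nsmul (ZMod N), ← Nat.cast_smul_eq_nsmul (ZMod N), smul_add, smul_smul,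
      smul_smul, hdε, zero_smul, add_zero, mul_sub, mul_one, hdε, sub_zero]

/-- The orthogonal complement of the span of `e` and `f`. -/
def pairPerp (e f : V) : Submodule (ZMod N) V := LinearMap.ker (ω e) ⊓ LinearMap.ker (ω f)

/-- A hyperbolic pair splits off a hyperbolic plane. -/
def hyperbolicSplit (alt : ∀ x, ω x x = 0) {e f : V} (hef : ω e f = 1) :
    V ≃ₗ[ZMod N] (ZMod N × ZMod N) × pairPerp ω e f where
  toFun v := ((ω v f, ω e v), ⟨v - ω v f • e - ω e v • f, by
    have hfe := neg_eq_of_alt ω alt e f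
    have hfv := neg_eq_of_alt ω alt v f
    simp [pairPerp, alt, hef, hfe, hfv]⟩)
  map_add' x y := by
    ext <;> simp
    module
  map_smul' r x := by
    ext <;> simp
    module
  invFun p := p.1.1 • e + p.1.2 • f + p.2
  left_inv v := by simp
  right_inv := by
    rintro ⟨⟨a, b⟩, v, hv⟩
    have hfe := neg_eq_of_alt ω alt e f
    obtain ⟨h1, h2⟩ : ω e v = 0 ∧ ω f v = 0 := by simpa [pairPerp] using hv
    have hvf := neg_eq_of_alt ω alt f v
    ext <;> simp [alt, hef, h1, h2, hvf]
    module


theorem apply_eq_hyperbolicSplit (alt : ∀ x, ω x x = 0) {e f : V} (hef : ω e f = 1) (x y : V) :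
    let s := hyperbolicSplit ω alt hef
    ω x y = (s x).1.1 * (s y).1.2 - (s x).1.2 * (s y).1.1 + ω (s x).2 (s y).2 := by
  have hfe := neg_eq_of_alt ω alt e f
  have hxe := neg_eq_of_alt ω alt e x
  have hfy := neg_eq_of_alt ω alt y f
  simp [hyperbolicSplit, alt, hef, hfe, hxe, hfy]
  ring

theorem card_torsion_hyperbolicSplit (alt : ∀ x, ω x x = 0) {e f : V} (hef : ω e f = 1) (k : ℕ) :
    Nat.card {x : V // k • x = 0} =
      Nat.card {a : ZMod N // k • a = 0} ^ 2 * Nat.card {x : pairPerp ω e f // k • x = 0} := by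
  rw [sq, ← Nat.card_nsmul_eq_zero_prod, ← Nat.card_nsmul_eq_zero_prod]
  refine Nat.card_congr ((hyperbolicSplit ω alt hef).toEquiv.subtypeEquiv fun x => ?_)
  change _ ↔ k • hyperbolicSplit ω alt hef x = 0
  rw [← map_nsmul, map_eq_zero_iff _ (hyperbolicSplit ω alt hef).injective]

theorem IsSymplecticForm.restrict_pairPerp [NeZero N] [Finite V] {g : ℕ} {ω}
    (hω : IsSymplecticForm N (g + 1) ω) {e f : V} (hef : ω e f = 1) :
    IsSymplecticForm N g (ω.domRestrict₁₂ (pairPerp ω e f) (pairPerp ω e f)) where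
  alt x := hω.alt x
  nondegenerate x hx := by
    obtain ⟨x, h⟩ := x
    obtain ⟨h1, h2⟩ : ω e x = 0 ∧ ω f x = 0 := by simpa [pairPerp] using h
    refine Subtype.ext (hω.nondegenerate x fun y => ?_)
    have hxy := hx (hyperbolicSplit ω hω.alt hef y).2
    have hxe := neg_eq_of_alt ω hω.alt e x
    have hxf := neg_eq_of_alt ω hω.alt f x
    rw [LinearMap.domRestrict₁₂_apply] at hxy
    simpa [hyperbolicSplit, hxe, hxf, h1, h2] using hxy
  divisible d m h x hx := by
    obtain ⟨y, hy⟩ := hω.divisible d m h x (by simpa using congrArg Subtype.val hx)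
    refine ⟨(hyperbolicSplit ω hω.alt hef y).2, ?_⟩
    have hx' : hyperbolicSplit ω hω.alt hef x = (0, x) := by
      rw [← LinearEquiv.eq_symm_apply]
      simp [hyperbolicSplit]
    rw [hy, map_nsmul] at hx'
    exact (congrArg Prod.snd hx').symm
  card_torsion k := by
    have h := hω.card_torsion k
    rw [card_torsion_hyperbolicSplit ω hω.alt hef, show 2 * (g + 1) = 2 + 2 * g by ring, pow_add]
      at h
    have : Nonempty {a : ZMod N // k • a = 0} := ⟨0, smul_zero k⟩
    exact Nat.eq_of_mul_eq_mul_left (pow_pos Nat.card_pos 2) h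

/-- A Lagrangian submodule of exponent `m` is homogeneous for the splitting given by a hyperbolic
pair `e`, `f` such that it contains `(N / m) • e`. -/
theorem mem_iff_hyperbolicSplit [NeZero N] (alt : ∀ x, ω x x = 0) {e f : V} (hef : ω e f = 1)
    {C : Submodule (ZMod N) V} (hC : ∀ v, v ∈ C ↔ ∀ w ∈ C, ω v w = 0) {d m : ℕ} (h : d * m = N)
    (hm : ∀ c ∈ C, m • c = 0) (he : d • e ∈ C) (v : V) :
    v ∈ C ↔ (m • (hyperbolicSplit ω alt hef v).1.1 = 0 ∧
      d • (hyperbolicSplit ω alt hef v).1.2 = 0) ∧ ((hyperbolicSplit ω alt hef v).2 : V) ∈ C := by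
  have hf : m • f ∈ C := (hC _).2 fun w hw => by
    rw [map_nsmul, LinearMap.smul_apply, ← map_nsmul, hm w hw, map_zero]
  have hae : ∀ a : ZMod N, m • a = 0 → a • e ∈ C := fun a ha => by
    obtain ⟨r, rfl⟩ := ZMod.exists_eq_nsmul_of_nsmul_eq_zero h ha
    rw [smul_assoc, smul_comm]
    exact C.smul_mem r he
  have hbf : ∀ b : ZMod N, d • b = 0 → b • f ∈ C := fun b hb => by
    obtain ⟨r, rfl⟩ := ZMod.exists_eq_nsmul_of_nsmul_eq_zero ((mul_comm m d).trans h) hb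
    rw [smul_assoc, smul_comm]
    exact C.smul_mem r hf
  change v ∈ C ↔ (m • ω v f = 0 ∧ d • ω e v = 0) ∧ v - ω v f • e - ω e v • f ∈ C
  constructor
  · intro hv
    have h1 : m • ω v f = 0 := by
      rw [← LinearMap.smul_apply, ← map_nsmul, hm v hv, map_zero, LinearMap.zero_apply]
    have h2 : d • ω e v = 0 := by
      rw [← LinearMap.smul_apply, ← map_nsmul, (hC _).1 he v hv]
    exact ⟨⟨h1, h2⟩, C.sub_mem (C.sub_mem hv (hae _ h1)) (hbf _ h2)⟩
  · rintro ⟨⟨h1, h2⟩, h3⟩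
    have := C.add_mem (C.add_mem h3 (hbf _ h2)) (hae _ h1)
    rwa [sub_add_cancel, sub_add_cancel] at this

theorem card_torsion_lagrangian_hyperbolicSplit [NeZero N] (alt : ∀ x, ω x x = 0) {e f : V}
    (hef : ω e f = 1) {C : Submodule (ZMod N) V} (hC : ∀ v, v ∈ C ↔ ∀ w ∈ C, ω v w = 0)
    {d m : ℕ} (h : d * m = N) (hm : ∀ c ∈ C, m • c = 0) (he : d • e ∈ C) (k : ℕ) :
    Nat.card {c : C // k • c = 0} =
      Nat.card {p : ZMod N × ZMod N // (m • p.1 = 0 ∧ d • p.2 = 0) ∧ k • p = 0} *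
        Nat.card {c : C.comap (pairPerp ω e f).subtype // k • c = 0} := by
  let s := hyperbolicSplit ω alt hef
  have hs : ∀ x, k • x = 0 ↔ k • (s x).1 = 0 ∧ k • (s x).2 = 0 := fun x => by
    rw [← map_eq_zero_iff _ s.injective, map_nsmul, Prod.ext_iff]
    rfl
  have flat : ∀ {W : Type _} [AddCommGroup W] [Module (ZMod N) W] (D : Submodule (ZMod N) W),
      Nat.card {c : D // k • c = 0} = Nat.card {x : W // x ∈ D ∧ k • x = 0} := fun D =>
    Nat.card_congr ((Equiv.subtypeEquivRight fun c => by simp [Subtype.ext_iff]).trans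
      (Equiv.subtypeSubtypeEquivSubtypeInter (· ∈ D) fun x => k • x = 0))
  rw [flat, flat, ← Nat.card_prod]
  refine Nat.card_congr ((s.toEquiv.subtypeEquiv (q := fun p =>
    ((m • p.1.1 = 0 ∧ d • p.1.2 = 0) ∧ k • p.1 = 0) ∧
      p.2 ∈ C.comap (pairPerp ω e f).subtype ∧ k • p.2 = 0) fun x => ?_).trans
    (Equiv.subtypeProdEquivProd (p := fun p : ZMod N × ZMod N =>
      (m • p.1 = 0 ∧ d • p.2 = 0) ∧ k • p = 0)
      (q := fun x => x ∈ C.comap (pairPerp ω e f).subtype ∧ k • x = 0)))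
  rw [mem_iff_hyperbolicSplit ω alt hef hC h hm he x, hs]
  simp only [LinearEquiv.coe_toEquiv, Submodule.mem_comap, Submodule.coe_subtype]
  tauto

/-- The part of a Lagrangian submodule orthogonal to a hyperbolic pair is Lagrangian. -/
theorem lagrangian_comap_pairPerp [NeZero N] (alt : ∀ x, ω x x = 0) {e f : V} (hef : ω e f = 1)
    {C : Submodule (ZMod N) V} (hC : ∀ v, v ∈ C ↔ ∀ w ∈ C, ω v w = 0) {d m : ℕ} (h : d * m = N)
    (hm : ∀ c ∈ C, m • c = 0) (he : d • e ∈ C) (v : pairPerp ω e f) :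
    v ∈ C.comap (pairPerp ω e f).subtype ↔ ∀ w ∈ C.comap (pairPerp ω e f).subtype,
      ω.domRestrict₁₂ (pairPerp ω e f) (pairPerp ω e f) v w = 0 := by
  refine ⟨fun hv w hw => (hC _).1 hv w hw, fun hv => (hC _).2 fun w hw => ?_⟩
  obtain ⟨v, hv'⟩ := v
  obtain ⟨h1, h2⟩ : ω e v = 0 ∧ ω f v = 0 := by simpa [pairPerp] using hv'
  have hve := neg_eq_of_alt ω alt e v
  have hvf := neg_eq_of_alt ω alt f v
  have := hv (hyperbolicSplit ω alt hef w).2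
    ((mem_iff_hyperbolicSplit ω alt hef hC h hm he w).1 hw).2
  rw [LinearMap.domRestrict₁₂_apply] at this
  simpa [hyperbolicSplit, hve, hvf, h1, h2] using this

end

/-- Lagrangian submodules with equally large torsion subgroups correspond under an isometry. -/
theorem exists_isometry_of_card_torsion_eq {N : ℕ} [NeZero N] (g : ℕ) :
    ∀ {V W : Type} [AddCommGroup V] [Module (ZMod N) V] [Finite V]
      [AddCommGroup W] [Module (ZMod N) W] [Finite W]
      {ω : V →ₗ[ZMod N] V →ₗ[ZMod N] ZMod N} {ω' : W →ₗ[ZMod N] W →ₗ[ZMod N] ZMod N}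
      (_ : IsSymplecticForm N g ω) (_ : IsSymplecticForm N g ω')
      {C : Submodule (ZMod N) V} {C' : Submodule (ZMod N) W}
      (_ : ∀ v, v ∈ C ↔ ∀ w ∈ C, ω v w = 0) (_ : ∀ v, v ∈ C' ↔ ∀ w ∈ C', ω' v w = 0)
      (_ : ∀ k : ℕ, Nat.card {c : C // k • c = 0} = Nat.card {c : C' // k • c = 0}),
      ∃ Ψ : V ≃ₗ[ZMod N] W, (∀ x y, ω' (Ψ x) (Ψ y) = ω x y) ∧ ∀ x, x ∈ C ↔ Ψ x ∈ C' := by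
  induction g with
  | zero =>
    intro V W _ _ _ _ _ _ ω ω' hω hω' C C' _ _ _
    have triv : ∀ {U : Type} [AddCommGroup U] [Module (ZMod N) U] [Finite U]
        {θ : U →ₗ[ZMod N] U →ₗ[ZMod N] ZMod N}, IsSymplecticForm N 0 θ → Subsingleton U :=
      fun {U} _ _ _ _ hθ => by
        have h := hθ.card_torsion 0
        rw [mul_zero, pow_zero, Nat.card_congr (Equiv.subtypeUnivEquiv fun a => zero_nsmul a)] at h
        exact (Nat.card_eq_one_iff_unique.1 h).1
    have := triv hω
    have := triv hω'
    refine ⟨0, fun x y => ?_, fun x => ?_⟩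
    · rw [Subsingleton.elim x 0, map_zero, map_zero, map_zero, LinearMap.zero_apply,
        LinearMap.zero_apply]
    · rw [Subsingleton.elim x 0, map_zero]
      exact iff_of_true C.zero_mem C'.zero_mem
  | succ g ih =>
    intro V W _ _ _ _ _ _ ω ω' hω hω' C C' hC hC' hcard
    obtain ⟨x, hx⟩ := AddMonoid.exists_addOrderOf_eq_exponent
      (AddMonoid.ExponentExists.of_finite (G := C))
    obtain ⟨x', hx'⟩ := AddMonoid.exists_addOrderOf_eq_exponent
      (AddMonoid.ExponentExists.of_finite (G := C'))
    have hexp : AddMonoid.exponent C' = AddMonoid.exponent C := by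
      refine Nat.dvd_right_iff_eq.1 fun k => ?_
      rw [AddMonoid.exponent_dvd_iff_forall_nsmul_eq_zero,
        AddMonoid.exponent_dvd_iff_forall_nsmul_eq_zero, forall_nsmul_eq_zero_iff_card,
        forall_nsmul_eq_zero_iff_card, hcard, hcard]
    rw [hexp] at hx'
    have hm : ∀ c ∈ C, AddMonoid.exponent C • c = 0 := fun c hc =>
      congrArg Subtype.val (AddMonoid.exponent_nsmul_eq_zero (⟨c, hc⟩ : C))
    have hm' : ∀ c ∈ C', AddMonoid.exponent C • c = 0 := fun c hc =>
      hexp ▸ congrArg Subtype.val (AddMonoid.exponent_nsmul_eq_zero (⟨c, hc⟩ : C'))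
    obtain ⟨d, hd⟩ : AddMonoid.exponent C ∣ N :=
      AddMonoid.exponent_dvd_iff_forall_nsmul_eq_zero.2 nsmul_eq_zero_of_zmod
    generalize AddMonoid.exponent C = m at hm hm' hx hx' hd
    have h : d * m = N := by rw [hd, mul_comm]
    have hxV : addOrderOf (x : V) = m := hx ▸
      addOrderOf_injective C.subtype.toAddMonoidHom Subtype.val_injective x
    have hxW : addOrderOf (x' : W) = m := hx' ▸
      addOrderOf_injective C'.subtype.toAddMonoidHom Subtype.val_injective x'
    obtain ⟨e, f, hef, he⟩ := hω.exists_hyperbolic_pair h hxV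
    obtain ⟨e', f', hef', he'⟩ := hω'.exists_hyperbolic_pair h hxW
    replace he : d • e ∈ C := he ▸ x.2
    replace he' : d • e' ∈ C' := he' ▸ x'.2
    obtain ⟨Ψ, hΨ, hΨC⟩ := ih (hω.restrict_pairPerp hef) (hω'.restrict_pairPerp hef')
      (lagrangian_comap_pairPerp ω hω.alt hef hC h hm he)
      (lagrangian_comap_pairPerp ω' hω'.alt hef' hC' h hm' he') fun k => by
        have hk := hcard k
        rw [card_torsion_lagrangian_hyperbolicSplit ω hω.alt hef hC h hm he,
          card_torsion_lagrangian_hyperbolicSplit ω' hω'.alt hef' hC' h hm' he'] at hk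
        have : Nonempty {p : ZMod N × ZMod N // (m • p.1 = 0 ∧ d • p.2 = 0) ∧ k • p = 0} :=
          ⟨0, by simp⟩
        exact Nat.eq_of_mul_eq_mul_left Nat.card_pos hk
    let s := hyperbolicSplit ω hω.alt hef
    let s' := hyperbolicSplit ω' hω'.alt hef'
    let Φ : V ≃ₗ[ZMod N] W :=
      s ≪≫ₗ (LinearEquiv.refl (ZMod N) (ZMod N × ZMod N)).prodCongr Ψ ≪≫ₗ s'.symm
    have hΦ : ∀ x, s' (Φ x) = ((s x).1, Ψ (s x).2) := fun x => by simp [Φ]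
    refine ⟨Φ, fun x y => ?_, fun x => ?_⟩
    · rw [apply_eq_hyperbolicSplit ω hω.alt hef, apply_eq_hyperbolicSplit ω' hω'.alt hef']
      change (s' (Φ x)).1.1 * (s' (Φ y)).1.2 - (s' (Φ x)).1.2 * (s' (Φ y)).1.1 +
        ω' (s' (Φ x)).2 (s' (Φ y)).2 = _
      rw [hΦ, hΦ]
      exact congrArg _ (hΨ _ _)
    · rw [mem_iff_hyperbolicSplit ω hω.alt hef hC h hm he,
        mem_iff_hyperbolicSplit ω' hω'.alt hef' hC' h hm' he']
      change _ ↔ (m • (s' (Φ x)).1.1 = 0 ∧ d • (s' (Φ x)).1.2 = 0) ∧ ((s' (Φ x)).2 : W) ∈ C'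
      rw [hΦ]
      exact and_congr_right fun _ => hΨC (s x).2

/-- The form `η` is the bilinear form of its matrix. -/
theorem etaForm_eq_dotProduct (N g : ℕ) (x y : Fin (2 * g) → ZMod N) :
    etaForm N g x y = x ⬝ᵥ etaMat N g *ᵥ y := by
  have hsum : ∀ F : Fin (2 * g) → ZMod N, ∑ i, F i =
      ∑ i : Fin g, F ⟨i.1, by have := i.2; omega⟩ +
        ∑ i : Fin g, F ⟨g + i.1, by have := i.2; omega⟩ := fun F => by
    rw [← (finCongr (two_mul g).symm).sum_comp, Fin.sum_univ_add]
    rfl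
  have hlow : ∀ i : Fin g, (etaMat N g *ᵥ y) ⟨i.1, by have := i.2; omega⟩ =
      -y ⟨g + i.1, by have := i.2; omega⟩ := fun i => by
    rw [Matrix.mulVec, dotProduct, Finset.sum_eq_single ⟨g + i.1, by have := i.2; omega⟩]
    · simp [etaMat, add_comm]
    · intro j _ hj
      have h1 : j.1 ≠ i.1 + g := fun h => hj (Fin.ext (h.trans (add_comm _ _)))
      have h2 : i.1 ≠ j.1 + g := by have := i.2; omega
      simp [etaMat, h1, h2]
    · simp
  have hhigh : ∀ i : Fin g, (etaMat N g *ᵥ y) ⟨g + i.1, by have := i.2; omega⟩ =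
      y ⟨i.1, by have := i.2; omega⟩ := fun i => by
    have hi := i.2
    rw [Matrix.mulVec, dotProduct, Finset.sum_eq_single ⟨i.1, by omega⟩]
    · have h1 : i.1 ≠ i.1 + g + g := by omega
      simp [etaMat, add_comm g i.1, h1]
    · intro j _ hj
      have h1 : j.1 ≠ g + i.1 + g := by have := j.2; omega
      have h2 : g + i.1 ≠ j.1 + g := fun h => hj (Fin.ext (by simp; omega))
      simp [etaMat, h1, h2]
    · simp
  rw [dotProduct, hsum, etaForm, Finset.sum_sub_distrib]
  simp only [hlow, hhigh, mul_neg, Finset.sum_neg_distrib]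
  ring

theorem isSymplecticForm_etaMat (N g : ℕ) [NeZero N] :
    IsSymplecticForm N g (Matrix.toLinearMap₂' (ZMod N) (etaMat N g)) where
  alt x := by
    rw [Matrix.toLinearMap₂'_apply', ← etaForm_eq_dotProduct]
    exact Finset.sum_eq_zero fun i _ => by ring
  nondegenerate x hx := by
    have hη : ∀ y, etaForm N g x y = 0 := fun y => by
      rw [etaForm_eq_dotProduct, ← Matrix.toLinearMap₂'_apply', hx]
    funext j
    by_cases hj : j.1 < g
    · have := hη (Pi.single ⟨g + j.1, by omega⟩ 1)
      rw [etaForm, Finset.sum_eq_single ⟨j.1, hj⟩] at this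
      · have h1 : j ≠ ⟨g + j.1, by omega⟩ := fun h => by
          have := congrArg Fin.val h
          simp only at this
          omega
        simpa [Pi.single_apply, h1] using this
      · intro i _ hi
        have h1 : i.1 ≠ g + j.1 := by have := i.2; omega
        have h2 : i.1 ≠ j.1 := fun h => hi (Fin.ext h)
        simp [h1, h2]
      · simp
    · obtain ⟨k, hk⟩ := Nat.exists_eq_add_of_le (not_lt.1 hj)
      have hkg : k < g := by have := j.2; omega
      have := hη (Pi.single ⟨k, by omega⟩ 1)
      rw [etaForm, Finset.sum_eq_single ⟨k, hkg⟩] at this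
      · have h1 : j ≠ ⟨k, by omega⟩ := fun h => by
          have := congrArg Fin.val h
          simp only at this
          omega
        simpa [Pi.single_apply, h1, ← hk] using this
      · intro i _ hi
        have h1 : g + i.1 ≠ k := by omega
        have h2 : i.1 ≠ k := fun h => hi (Fin.ext h)
        simp [h1, h2]
      · simp
  divisible d m h x hx := by
    choose y hy using fun i => ZMod.exists_eq_nsmul_of_nsmul_eq_zero h (congrFun hx i)
    exact ⟨y, funext hy⟩
  card_torsion k := by
    have e : {x : Fin (2 * g) → ZMod N // k • x = 0} ≃
        (Fin (2 * g) → {a : ZMod N // k • a = 0}) :=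
      (Equiv.subtypeEquivRight fun x => funext_iff).trans
        (Equiv.subtypePiEquivPi (p := fun _ a => k • a = 0))
    rw [Nat.card_congr e, Nat.card_fun, Nat.card_fin]

/-- Lagrangian submodules of `(ZMod N)^{2g}` that are isomorphic as additive groups
belong to the same `Sp(2g, ZMod N)`-orbit. -/
theorem lagrangian_iso_symplectic_orbit (N g : ℕ) (hN : 1 ≤ N) (hg : 1 ≤ g)
    (C C' : Submodule (ZMod N) (Fin (2 * g) → ZMod N))
    (hC : ∀ v, v ∈ C ↔ ∀ w ∈ C, etaForm N g v w = 0)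
    (hC' : ∀ v, v ∈ C' ↔ ∀ w ∈ C', etaForm N g v w = 0)
    (hiso : Nonempty (C ≃+ C')) :
    ∃ γ : Matrix (Fin (2 * g)) (Fin (2 * g)) (ZMod N),
      γ * etaMat N g * γᵀ = etaMat N g ∧
      C' = Submodule.map (Matrix.vecMulLinear γ) C := by
  have : NeZero N := ⟨by omega⟩
  obtain ⟨φ⟩ := hiso
  have happ : ∀ x y, Matrix.toLinearMap₂' (ZMod N) (etaMat N g) x y = etaForm N g x y :=
    fun x y => by rw [Matrix.toLinearMap₂'_apply', etaForm_eq_dotProduct]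
  obtain ⟨Ψ, hΨ, hΨC⟩ := exists_isometry_of_card_torsion_eq g (isSymplecticForm_etaMat N g)
    (isSymplecticForm_etaMat N g) (C := C) (C' := C') (by simpa only [happ] using hC)
    (by simpa only [happ] using hC') fun k =>
      Nat.card_congr (φ.toEquiv.subtypeEquiv fun c => by
        change _ ↔ k • φ c = 0
        rw [← map_nsmul, map_eq_zero_iff _ φ.injective])
  have hγ : ∀ v, v ᵥ* (LinearMap.toMatrix' (Ψ : _ →ₗ[ZMod N] _))ᵀ = Ψ v := fun v => by
    rw [Matrix.vecMul_transpose, LinearMap.toMatrix'_mulVec]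
    rfl
  refine ⟨(LinearMap.toMatrix' (Ψ : _ →ₗ[ZMod N] _))ᵀ, ?_, ?_⟩
  · let B : Matrix (Fin (2 * g)) (Fin (2 * g)) (ZMod N) ≃ₗ[ZMod N] (Fin (2 * g) → ZMod N)
        →ₗ[ZMod N] (Fin (2 * g) → ZMod N) →ₗ[ZMod N] ZMod N := Matrix.toLinearMap₂' (ZMod N)
    refine B.injective (LinearMap.ext₂ fun x y => ?_)
    rw [← hΨ x y, Matrix.toLinearMap₂'_apply', Matrix.toLinearMap₂'_apply', ← hγ x, ← hγ y,
      ← Matrix.dotProduct_mulVec, Matrix.mulVec_mulVec, ← Matrix.mulVec_transpose _ y,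
      Matrix.mulVec_mulVec]
  · ext v
    simp only [Submodule.mem_map, Matrix.vecMulLinear_apply, hγ]
    refine ⟨fun hv => ⟨Ψ.symm v, (hΨC _).2 (by simpa using hv), by simp⟩, ?_⟩
    rintro ⟨w, hw, rfl⟩
    exact (hΨC w).1 hw
end

section
/- (Classification of orthogonal Lagrangian submodules.) Let N ≥ 1 be odd and n ≥ 1. A ZMod N-submodule L of (ZMod N)^{2n} is Lagrangian with respect to the antidiagonal bilinear form b if and only if there exist positive integers q₁, …, q_n with q₁ ∣ q₂ ∣ ⋯ ∣ q_n and q_n² ∣ N, and a 2n×2n matrix Q over ZMod N with Q·A·Qᵀ = A (where A is the antidiagonal matrix of b, i.e. A_{i,j} = 1 if i + j = 2n + 1 and 0 otherwise), such that L is the row span over ZMod N of the matrix diag(q₁, …, q_n, N/q_n, …, N/q₁) · Q, the diagonal entries being cast into ZMod N. -/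
open Matrix

/-- The antidiagonal bilinear form on `(ZMod N)^{2n}`:
`b(x,y) = ∑_{i=1}^{2n} x_i y_{2n+1−i}`. -/
def adForm (N n : ℕ) (x y : Fin (2 * n) → ZMod N) : ZMod N :=
  ∑ i, x i * y i.rev

/-- The antidiagonal matrix of the form `b` (entry 1 when `i + j = 2n + 1`, 1-based). -/
def adMat (N n : ℕ) : Matrix (Fin (2 * n)) (Fin (2 * n)) (ZMod N) :=
  Matrix.of fun i j => if i.1 + j.1 = 2 * n - 1 then 1 else 0

section Arithmetic

/-- In a finite quotient of `ℤ`, the ideal `(a, b)` is generated by a combination of `a` and `b`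
with complementary idempotent coefficients. -/
theorem ZMod.exists_idempotent_combination_dvd (N : ℕ) (hN : 0 < N) :
    ∀ a b : ZMod N, ∃ ε : ZMod N, ε * ε = ε ∧
      ε * a + (1 - ε) * b ∣ a ∧ ε * a + (1 - ε) * b ∣ b := by
  induction N using Nat.recOnPosPrimePosCoprime with
  | zero => omega
  | one => exact fun a b => ⟨1, Subsingleton.elim _ _, by simp, by simp [Subsingleton.elim b a]⟩
  | prime_pow p k hp hk =>
    intro a b
    have : Fact p.Prime := ⟨hp⟩
    obtain ⟨x, rfl⟩ := ZMod.ringHom_surjective (PadicInt.toZModPow (p := p) k) a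
    obtain ⟨y, rfl⟩ := ZMod.ringHom_surjective (PadicInt.toZModPow (p := p) k) b
    rcases ValuationRing.dvd_total x y with h | h
    · exact ⟨1, by simp, by simp, by simpa using map_dvd _ h⟩
    · exact ⟨0, by simp, by simpa using map_dvd _ h, by simp⟩
  | coprime m n hm hn hmn ihm ihn =>
    intro a b
    let φ := ZMod.chineseRemainder hmn
    obtain ⟨s, hs, hsa, hsb⟩ := ihm (by omega) (φ a).1 (φ b).1
    obtain ⟨t, ht, hta, htb⟩ := ihn (by omega) (φ a).2 (φ b).2
    refine ⟨φ.symm (s, t), ?_, ?_, ?_⟩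
    · rw [← map_mul, Prod.mk_mul_mk, hs, ht]
    · rw [← map_dvd_iff φ, prod_dvd_iff]
      simpa using ⟨hsa, hta⟩
    · rw [← map_dvd_iff φ, prod_dvd_iff]
      simpa using ⟨hsb, htb⟩

theorem ZMod.natCast_dvd_natCast_iff_of_dvd {N d : ℕ} (hd : d ∣ N) (m : ℕ) :
    (d : ZMod N) ∣ (m : ZMod N) ↔ d ∣ m := by
  refine ⟨fun h => ?_, fun h => Nat.cast_dvd_cast h⟩
  have := map_dvd (ZMod.castHom hd (ZMod d)) h
  simpa [ZMod.natCast_eq_zero_iff] using this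

theorem ZMod.natCast_div_dvd_of_mul_eq_zero {N d : ℕ} (hN : 0 < N) (hd : d ∣ N) {x : ZMod N}
    (hx : (d : ZMod N) * x = 0) : ((N / d : ℕ) : ZMod N) ∣ x := by
  have : NeZero N := ⟨hN.ne'⟩
  obtain ⟨k, rfl⟩ := ZMod.natCast_zmod_surjective x
  rw [← Nat.cast_mul, ZMod.natCast_eq_zero_iff] at hx
  exact Nat.cast_dvd_cast ((Nat.div_dvd_iff_dvd_mul hd (Nat.pos_of_dvd_of_pos hd hN)).2 hx)

theorem ZMod.natCast_mul_natCast_div {N d : ℕ} (hd : d ∣ N) :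
    (d : ZMod N) * ((N / d : ℕ) : ZMod N) = 0 := by
  rw [← Nat.cast_mul, Nat.mul_div_cancel' hd, ZMod.natCast_self]

end Arithmetic

section Hyperbolic

variable {R V : Type*} [CommRing R] [AddCommGroup V] [Module R V]

/-- The families `e` and `f` are isotropic and dual to each other for the form `B`. -/
structure IsHyperbolic (B : LinearMap.BilinForm R V) {n : ℕ} (e f : Fin n → V) : Prop where
  left : ∀ i j, B (e i) (e j) = 0
  right : ∀ i j, B (f i) (f j) = 0
  pairing : ∀ i j, B (e i) (f j) = if i = j then 1 else 0

/-- The span of a pair of families. -/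
def pairSpan (R : Type*) {V : Type*} [CommRing R] [AddCommGroup V] [Module R V] {n : ℕ}
    (e f : Fin n → V) : Submodule R V :=
  Submodule.span R (Set.range e ∪ Set.range f)

variable {n : ℕ} {e f e' f' : Fin n → V}

theorem left_mem_pairSpan (i : Fin n) : e i ∈ pairSpan R e f :=
  Submodule.subset_span (Or.inl ⟨i, rfl⟩)

theorem right_mem_pairSpan (i : Fin n) : f i ∈ pairSpan R e f :=
  Submodule.subset_span (Or.inr ⟨i, rfl⟩)

theorem pairSpan_le {W : Submodule R V} :
    pairSpan R e f ≤ W ↔ (∀ i, e i ∈ W) ∧ ∀ i, f i ∈ W := by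
  simp [pairSpan, Submodule.span_le, Set.range_subset_iff]

theorem pairSpan_swap : pairSpan R f e = pairSpan R e f := by
  rw [pairSpan, pairSpan, Set.union_comm]

theorem pairSpan_comp_perm (σ : Equiv.Perm (Fin n)) :
    pairSpan R (e ∘ σ) (f ∘ σ) = pairSpan R e f := by
  simp [pairSpan, σ.surjective.range_comp]

/-- Gluing of two families along an idempotent. -/
theorem pairSpan_glue {ε : R} (hε : ε * ε = ε) (h : pairSpan R e' f' = pairSpan R e f) :
    pairSpan R (ε • e + (1 - ε) • e') (ε • f + (1 - ε) • f') = pairSpan R e f := by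
  apply le_antisymm
  · refine pairSpan_le.2 ⟨fun i => ?_, fun i => ?_⟩
    · exact add_mem (Submodule.smul_mem _ _ (left_mem_pairSpan i))
        (Submodule.smul_mem _ _ (h ▸ left_mem_pairSpan i))
    · exact add_mem (Submodule.smul_mem _ _ (right_mem_pairSpan i))
        (Submodule.smul_mem _ _ (h ▸ right_mem_pairSpan i))
  · set W := pairSpan R (ε • e + (1 - ε) • e') (ε • f + (1 - ε) • f') with hW
    have h₁ : ∀ x y : V, ε • (ε • x + (1 - ε) • y) = ε • x := fun x y => by
      rw [smul_add, smul_smul, smul_smul, mul_sub, hε]; simp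
    have h₂ : ∀ x y : V, (1 - ε) • (ε • x + (1 - ε) • y) = (1 - ε) • y := fun x y => by
      rw [smul_add, smul_smul, smul_smul, mul_sub, sub_mul, hε]; simp
    have hle : ∀ x ∈ pairSpan R e f, ε • x ∈ W := by
      refine fun x hx => (pairSpan_le (W := W.comap (LinearMap.lsmul R V ε))).2 ⟨?_, ?_⟩ hx
      · intro i
        have := W.smul_mem ε (left_mem_pairSpan (R := R) (e := ε • e + (1 - ε) • e') i)
        simpa [h₁] using this
      · intro i
        have := W.smul_mem ε (right_mem_pairSpan (R := R) (f := ε • f + (1 - ε) • f') i)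
        simpa [h₁] using this
    have hle' : ∀ x ∈ pairSpan R e' f', (1 - ε) • x ∈ W := by
      refine fun x hx => (pairSpan_le (W := W.comap (LinearMap.lsmul R V (1 - ε)))).2 ⟨?_, ?_⟩ hx
      · intro i
        have := W.smul_mem (1 - ε) (left_mem_pairSpan (R := R) (e := ε • e + (1 - ε) • e') i)
        simpa only [Pi.add_apply, Pi.smul_apply, h₂, Submodule.mem_comap,
          LinearMap.lsmul_apply] using this
      · intro i
        have := W.smul_mem (1 - ε) (right_mem_pairSpan (R := R) (f := ε • f + (1 - ε) • f') i)
        simpa only [Pi.add_apply, Pi.smul_apply, h₂, Submodule.mem_comap,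
          LinearMap.lsmul_apply] using this
    intro x hx
    have := add_mem (hle x hx) (hle' x (h ▸ hx))
    rwa [← add_smul, add_sub_cancel, one_smul] at this

variable {B : LinearMap.BilinForm R V}

namespace IsHyperbolic

theorem swap (hB : ∀ x y, B x y = B y x) (h : IsHyperbolic B e f) : IsHyperbolic B f e :=
  ⟨h.right, h.left, fun i j => by rw [hB, h.pairing]; simp [eq_comm]⟩

theorem comp_perm (h : IsHyperbolic B e f) (σ : Equiv.Perm (Fin n)) :
    IsHyperbolic B (e ∘ σ) (f ∘ σ) :=
  ⟨fun i j => h.left _ _, fun i j => h.right _ _, fun i j => by simp [h.pairing]⟩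

theorem glue {ε : R} (hε : ε * ε = ε) (h : IsHyperbolic B e f) (h' : IsHyperbolic B e' f') :
    IsHyperbolic B (ε • e + (1 - ε) • e') (ε • f + (1 - ε) • f') := by
  refine ⟨fun i j => ?_, fun i j => ?_, fun i j => ?_⟩
  · simp only [Pi.add_apply, Pi.smul_apply, map_add, map_smul, LinearMap.add_apply,
      LinearMap.smul_apply, smul_eq_mul, h.left, h'.left]
    linear_combination -(B (e i) (e' j) + B (e' i) (e j)) * hε
  · simp only [Pi.add_apply, Pi.smul_apply, map_add, map_smul, LinearMap.add_apply,
      LinearMap.smul_apply, smul_eq_mul, h.right, h'.right]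
    linear_combination -(B (f i) (f' j) + B (f' i) (f j)) * hε
  · simp only [Pi.add_apply, Pi.smul_apply, map_add, map_smul, LinearMap.add_apply,
      LinearMap.smul_apply, smul_eq_mul, h.pairing, h'.pairing]
    linear_combination
      (2 * (if i = j then 1 else 0) - (B (e i) (f' j) + B (e' i) (f j))) * hε

/-- A vector in the span of a hyperbolic pair of families is determined by its pairings. -/
theorem sum_eq (hB : ∀ x y, B x y = B y x) (h : IsHyperbolic B e f) {x : V}
    (hx : x ∈ pairSpan R e f) : ∑ i, (B x (f i) • e i + B x (e i) • f i) = x := by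
  induction hx using Submodule.span_induction with
  | mem x hx =>
    rcases hx with ⟨j, rfl⟩ | ⟨j, rfl⟩
    · simp [h.left, h.pairing, ite_smul]
    · simp [h.right, (h.swap hB).pairing, ite_smul]
  | zero => simp
  | add x y _ _ hx hy =>
    conv_rhs => rw [← hx, ← hy, ← Finset.sum_add_distrib]
    refine Finset.sum_congr rfl fun i _ => ?_
    simp only [map_add, LinearMap.add_apply, add_smul]
    abel
  | smul a x _ hx =>
    conv_rhs => rw [← hx, Finset.smul_sum]
    refine Finset.sum_congr rfl fun i _ => ?_
    simp [smul_smul]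

end IsHyperbolic

theorem dvd_of_mem_pairSpan {g : R} {w x : V} (he : ∀ i, g ∣ B w (e i)) (hf : ∀ i, g ∣ B w (f i))
    (hx : x ∈ pairSpan R e f) : g ∣ B w x := by
  have : pairSpan R e f ≤ Submodule.comap (B w) (Ideal.span {g}) :=
    pairSpan_le.2 ⟨fun i => by simpa [Ideal.mem_span_singleton] using he i,
      fun i => by simpa [Ideal.mem_span_singleton] using hf i⟩
  simpa [Ideal.mem_span_singleton] using this hx

theorem eq_zero_of_mem_pairSpan {w x : V} (he : ∀ i, B w (e i) = 0) (hf : ∀ i, B w (f i) = 0)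
    (hx : x ∈ pairSpan R e f) : B w x = 0 :=
  zero_dvd_iff.1 (dvd_of_mem_pairSpan (fun i => by simp [he i]) (fun i => by simp [hf i]) hx)

/-- Over a Noetherian ring in which ideals with two generators are generated by idempotent
combinations, a hyperbolic pair of families can be changed so that some vector of `L` has a first
coordinate dividing all coordinates of all vectors of `L`. -/
theorem IsHyperbolic.exists_dvd [IsNoetherianRing R]
    (hR : ∀ a b : R, ∃ ε : R, ε * ε = ε ∧
      ε * a + (1 - ε) * b ∣ a ∧ ε * a + (1 - ε) * b ∣ b)
    (hB : ∀ x y, B x y = B y x) {e f : Fin (n + 1) → V} (h : IsHyperbolic B e f)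
    (L : Submodule R V) :
    ∃ (e' f' : Fin (n + 1) → V) (v : V), IsHyperbolic B e' f' ∧
      pairSpan R e' f' = pairSpan R e f ∧ v ∈ L ∧
      ∀ w ∈ L, ∀ x ∈ pairSpan R e f, B v (f' 0) ∣ B w x := by
  let S : Set (Ideal R) := {I | ∃ (e' f' : Fin (n + 1) → V) (v : V), IsHyperbolic B e' f' ∧
    pairSpan R e' f' = pairSpan R e f ∧ v ∈ L ∧ I = Ideal.span {B v (f' 0)}}
  obtain ⟨_, ⟨e', f', v, hef, hspan, hv, rfl⟩, hmax⟩ :=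
    set_has_maximal_iff_noetherian.2 ‹IsNoetherianRing R› S
      ⟨_, e, f, 0, h, rfl, L.zero_mem, rfl⟩
  refine ⟨e', f', v, hef, hspan, hv, fun w hw => ?_⟩
  have key : ∀ e'' f'' : Fin (n + 1) → V, IsHyperbolic B e'' f'' →
      pairSpan R e'' f'' = pairSpan R e' f' → B v (f' 0) ∣ B w (f'' 0) := by
    intro e'' f'' h'' hspan''
    obtain ⟨ε, hε, hdvd₁, hdvd₂⟩ := hR (B v (f' 0)) (B w (f'' 0))
    have hval : B (ε • v + (1 - ε) • w) ((ε • f' + (1 - ε) • f'') 0) =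
        ε * B v (f' 0) + (1 - ε) * B w (f'' 0) := by
      simp only [Pi.add_apply, Pi.smul_apply, map_add, map_smul, LinearMap.add_apply,
        LinearMap.smul_apply, smul_eq_mul]
      linear_combination (B v (f' 0) + B w (f'' 0) - B v (f'' 0) - B w (f' 0)) * hε
    have hnot := hmax _ ⟨_, _, ε • v + (1 - ε) • w, hef.glue hε h'',
      (pairSpan_glue hε hspan'').trans hspan,
      add_mem (L.smul_mem _ hv) (L.smul_mem _ hw), rfl⟩
    rw [hval] at hnot
    have hle := Ideal.span_singleton_le_span_singleton.2 hdvd₁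
    have heq := hle.eq_or_lt.resolve_right hnot
    exact (Ideal.span_singleton_le_span_singleton.1 heq.ge).trans hdvd₂
  intro x hx
  rw [← hspan] at hx
  refine dvd_of_mem_pairSpan (fun i => ?_) (fun i => ?_) hx
  · simpa using key _ _ ((hef.swap hB).comp_perm (Equiv.swap 0 i))
      ((pairSpan_comp_perm _).trans pairSpan_swap)
  · simpa using key _ _ (hef.comp_perm (Equiv.swap 0 i)) (pairSpan_comp_perm _)

theorem IsHyperbolic.cons (hB : ∀ x y, B x y = B y x) (h : IsHyperbolic B e f) {a b : V}
    (haa : B a a = 0) (hbb : B b b = 0) (hab : B a b = 1)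
    (ha : ∀ x ∈ pairSpan R e f, B a x = 0) (hb : ∀ x ∈ pairSpan R e f, B b x = 0) :
    IsHyperbolic B (Fin.cons a e : Fin (n + 1) → V) (Fin.cons b f : Fin (n + 1) → V) := by
  refine ⟨fun i j => ?_, fun i j => ?_, fun i j => ?_⟩ <;>
    refine Fin.cases ?_ (fun i => ?_) i <;> refine Fin.cases ?_ (fun j => ?_) j
  · simpa
  · simpa using ha _ (left_mem_pairSpan j)
  · simpa [hB _ a] using ha _ (left_mem_pairSpan i)
  · simpa using h.left i j
  · simpa
  · simpa using hb _ (right_mem_pairSpan j)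
  · simpa [hB _ b] using hb _ (right_mem_pairSpan i)
  · simpa using h.right i j
  · simpa
  · simpa [(Fin.succ_ne_zero j).symm] using ha _ (right_mem_pairSpan j)
  · simpa [hB _ b] using hb _ (left_mem_pairSpan i)
  · simpa using h.pairing i j

theorem pairSpan_cons_le {a b : V} {W : Submodule R V} :
    pairSpan R (Fin.cons a e : Fin (n + 1) → V) (Fin.cons b f : Fin (n + 1) → V) ≤ W ↔
      a ∈ W ∧ b ∈ W ∧ pairSpan R e f ≤ W := by
  simp only [pairSpan_le, Fin.forall_fin_succ, Fin.cons_zero, Fin.cons_succ]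
  tauto

/-- A vector `u` with first coordinate `1` spans, together with `f 0`, a plane whose orthogonal
complement in the span of a hyperbolic pair of families is spanned by a hyperbolic pair. -/
theorem IsHyperbolic.exists_cons (hB : ∀ x y, B x y = B y x) {e f : Fin (n + 1) → V}
    (h : IsHyperbolic B e f) {u : V} (hu : u ∈ pairSpan R e f) (huf : B u (f 0) = 1) :
    ∃ e' f' : Fin n → V, IsHyperbolic B e' f' ∧
      (∀ x ∈ pairSpan R e' f', B u x = 0) ∧ (∀ x ∈ pairSpan R e' f', B (f 0) x = 0) ∧
      pairSpan R (Fin.cons u e' : Fin (n + 1) → V) (Fin.cons (f 0) f' : Fin (n + 1) → V) =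
        pairSpan R e f := by
  have hfe : ∀ j : Fin n, B (f 0) (e j.succ) = 0 := fun j => by
    rw [hB, h.pairing, if_neg (Fin.succ_ne_zero j)]
  have hef : ∀ j : Fin n, B (e j.succ) (f 0) = 0 := fun j => by rw [hB, hfe]
  refine ⟨fun j => e j.succ - B u (e j.succ) • f 0, fun j => f j.succ - B u (f j.succ) • f 0,
    ⟨fun i j => ?_, fun i j => ?_, fun i j => ?_⟩, fun x hx => ?_, fun x hx => ?_, ?_⟩
  · simp [h.left, h.right, hfe, hef]
  · simp [h.right]
  · simp [h.right, h.pairing]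
  · exact eq_zero_of_mem_pairSpan (fun i => by simp [huf]) (fun i => by simp [huf]) hx
  · exact eq_zero_of_mem_pairSpan (fun i => by simp [h.right, hfe])
      (fun i => by simp [h.right]) hx
  · apply le_antisymm
    · exact pairSpan_cons_le.2 ⟨hu, right_mem_pairSpan 0, pairSpan_le.2
        ⟨fun i => sub_mem (left_mem_pairSpan _) (Submodule.smul_mem _ _ (right_mem_pairSpan 0)),
          fun i => sub_mem (right_mem_pairSpan _) (Submodule.smul_mem _ _ (right_mem_pairSpan 0))⟩⟩
    · set W := pairSpan R (Fin.cons u _ : Fin (n + 1) → V) (Fin.cons (f 0) _ : Fin (n + 1) → V)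
        with hW
      obtain ⟨huW, hfW, hW'⟩ := pairSpan_cons_le.1 hW.ge
      obtain ⟨he', hf'⟩ := pairSpan_le.1 hW'
      have hes : ∀ i : Fin n, e i.succ ∈ W := fun i => by
        simpa using add_mem (he' i) (W.smul_mem (B u (e i.succ)) hfW)
      have hfs : ∀ i : Fin n, f i.succ ∈ W := fun i => by
        simpa using add_mem (hf' i) (W.smul_mem (B u (f i.succ)) hfW)
      have hsum := h.sum_eq hB hu
      rw [Fin.sum_univ_succ, huf, one_smul, add_assoc] at hsum
      refine pairSpan_le.2 ⟨Fin.cases ?_ hes, Fin.cases hfW hfs⟩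
      rw [eq_sub_of_add_eq hsum]
      exact sub_mem huW (add_mem (W.smul_mem _ hfW) (sum_mem fun i _ =>
        add_mem (W.smul_mem _ (hes i)) (W.smul_mem _ (hfs i))))

end Hyperbolic

section Adapted

variable {N : ℕ} {V : Type*} [AddCommGroup V] [Module (ZMod N) V]
  {B : LinearMap.BilinForm (ZMod N) V}

/-- A Lagrangian submodule of a hyperbolic module splits off a hyperbolic plane. -/
theorem IsHyperbolic.exists_splitting (hN : 0 < N) (hodd : Odd N) (hB : ∀ x y, B x y = B y x)
    {n : ℕ} {e f : Fin (n + 1) → V} (h : IsHyperbolic B e f) {L : Submodule (ZMod N) V}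
    (hLW : L ≤ pairSpan (ZMod N) e f)
    (hL : ∀ v ∈ pairSpan (ZMod N) e f, v ∈ L ↔ ∀ w ∈ L, B v w = 0) :
    ∃ (q : ℕ) (a b : V) (e' f' : Fin n → V), q ^ 2 ∣ N ∧
      B a a = 0 ∧ B b b = 0 ∧ B a b = 1 ∧ IsHyperbolic B e' f' ∧
      (∀ x ∈ pairSpan (ZMod N) e' f', B a x = 0) ∧
      (∀ x ∈ pairSpan (ZMod N) e' f', B b x = 0) ∧
      pairSpan (ZMod N) (Fin.cons a e' : Fin (n + 1) → V) (Fin.cons b f' : Fin (n + 1) → V) =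
        pairSpan (ZMod N) e f ∧
      (q : ZMod N) • a ∈ L ∧ ((N / q : ℕ) : ZMod N) • b ∈ L ∧
      ∀ w ∈ L, ∀ x ∈ pairSpan (ZMod N) e f, (q : ZMod N) ∣ B w x := by
  have : NeZero N := ⟨hN.ne'⟩
  obtain ⟨c, hc⟩ : IsUnit (2 : ZMod N) := by
    have := (ZMod.isUnit_iff_coprime 2 N).2 (Nat.coprime_two_left.2 hodd)
    simpa using this
  obtain ⟨e₁, f₁, v, h₁, hspan, hv, hdvd⟩ :=
    h.exists_dvd (ZMod.exists_idempotent_combination_dvd N hN) hB L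
  rw [← hspan] at hLW hL hdvd ⊢
  obtain ⟨q, hqN, g, hg, hvq⟩ := ZMod.eq_unit_mul_divisor (B v (f₁ 0))
  obtain ⟨g, rfl⟩ := hg
  have hqdvd : ∀ w ∈ L, ∀ x ∈ pairSpan (ZMod N) e₁ f₁, (q : ZMod N) ∣ B w x :=
    fun w hw x hx => (Dvd.intro_left _ hvq.symm).trans (hdvd w hw x hx)
  have hmem : ∀ x ∈ pairSpan (ZMod N) e₁ f₁, ((N / q : ℕ) : ZMod N) • x ∈ L := by
    refine fun x hx => (hL _ (Submodule.smul_mem _ _ hx)).2 fun w hw => ?_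
    obtain ⟨y, hy⟩ := hqdvd w hw x hx
    rw [map_smul, LinearMap.smul_apply, hB, hy, smul_eq_mul]
    linear_combination y * ZMod.natCast_mul_natCast_div hqN
  have hmem' : ∀ t : ZMod N, (q : ZMod N) * t = 0 →
      ∀ x ∈ pairSpan (ZMod N) e₁ f₁, t • x ∈ L := by
    intro t ht x hx
    obtain ⟨s, rfl⟩ := ZMod.natCast_div_dvd_of_mul_eq_zero hN hqN ht
    rw [mul_comm, mul_smul]
    exact L.smul_mem _ (hmem x hx)
  have hsq : q ^ 2 ∣ N := by
    have := hqdvd _ (hmem _ (left_mem_pairSpan 0)) _ (right_mem_pairSpan 0)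
    rw [map_smul, LinearMap.smul_apply, h₁.pairing, if_pos rfl, smul_eq_mul, mul_one,
      ZMod.natCast_dvd_natCast_iff_of_dvd hqN] at this
    obtain ⟨k, hk⟩ := this
    exact ⟨k, by rw [← Nat.mul_div_cancel' hqN, hk]; ring⟩
  -- a vector `u` with `q • u ∈ L` and first coordinate `1`
  obtain ⟨u, hu, huf, huL⟩ : ∃ u ∈ pairSpan (ZMod N) e₁ f₁, B u (f₁ 0) = 1 ∧
      (q : ZMod N) • u ∈ L := by
    set w : V := (↑g⁻¹ : ZMod N) • v with hw
    have hwL : w ∈ L := L.smul_mem _ hv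
    have hw0 : B w (f₁ 0) = q := by
      rw [hw, map_smul, LinearMap.smul_apply, hvq, smul_eq_mul, Units.inv_mul_cancel_left]
    choose α hα using fun i => hqdvd w hwL _ (right_mem_pairSpan i)
    choose β hβ using fun i => hqdvd w hwL _ (left_mem_pairSpan i)
    have hsum := h₁.sum_eq hB (hLW hwL)
    rw [Fin.sum_univ_succ, hw0] at hsum
    refine ⟨e₁ 0 + β 0 • f₁ 0 + ∑ i : Fin n, (α i.succ • e₁ i.succ + β i.succ • f₁ i.succ),
      ?_, ?_, ?_⟩
    · exact add_mem (add_mem (left_mem_pairSpan _) (Submodule.smul_mem _ _ (right_mem_pairSpan _)))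
        (sum_mem fun i _ => add_mem (Submodule.smul_mem _ _ (left_mem_pairSpan _))
          (Submodule.smul_mem _ _ (right_mem_pairSpan _)))
    · simp [h₁.pairing, h₁.right, LinearMap.sum_apply]
    · convert hwL using 1
      rw [← hsum]
      simp only [smul_add, Finset.smul_sum, smul_smul, hα, hβ]
  obtain ⟨s, hs⟩ : ∃ s : ZMod N, 2 * s = B u u :=
    ⟨↑c⁻¹ * B u u, by rw [← hc, Units.mul_inv_cancel_left]⟩
  have hfu : B (f₁ 0) u = 1 := by rw [hB, huf]
  have hqs : (q : ZMod N) * (q * s) = 0 := by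
    have := (hL _ (hLW huL)).1 huL _ huL
    simp only [map_smul, LinearMap.smul_apply, smul_eq_mul, ← hs] at this
    rw [← c.mul_right_eq_zero, hc]
    linear_combination this
  have ha : u - s • f₁ 0 ∈ pairSpan (ZMod N) e₁ f₁ :=
    sub_mem hu (Submodule.smul_mem _ _ (right_mem_pairSpan _))
  have haf : B (u - s • f₁ 0) (f₁ 0) = 1 := by simp [huf, h₁.right]
  have haa : B (u - s • f₁ 0) (u - s • f₁ 0) = 0 := by
    simp only [map_sub, map_smul, LinearMap.sub_apply, LinearMap.smul_apply, smul_eq_mul, huf, hfu,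
      h₁.right]
    linear_combination -hs
  obtain ⟨e', f', h', hae, hbe, hspan'⟩ := h₁.exists_cons hB ha haf
  refine ⟨q, u - s • f₁ 0, f₁ 0, e', f', hsq, haa, h₁.right _ _, haf, h', hae, hbe, hspan', ?_,
    hmem _ (right_mem_pairSpan _), hqdvd⟩
  rw [smul_sub, smul_smul]
  exact sub_mem huL (hmem' _ hqs _ (right_mem_pairSpan _))

/-- A Lagrangian submodule of a hyperbolic module over `ZMod N` is diagonal in a suitable hyperbolic
pair of families. -/
theorem IsHyperbolic.exists_adapted (hN : 0 < N) (hodd : Odd N) (hB : ∀ x y, B x y = B y x)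
    {n : ℕ} {e f : Fin n → V} (h : IsHyperbolic B e f) {L : Submodule (ZMod N) V}
    (hLW : L ≤ pairSpan (ZMod N) e f)
    (hL : ∀ v ∈ pairSpan (ZMod N) e f, v ∈ L ↔ ∀ w ∈ L, B v w = 0) :
    ∃ (q : Fin n → ℕ) (e' f' : Fin n → V), IsHyperbolic B e' f' ∧
      pairSpan (ZMod N) e' f' = pairSpan (ZMod N) e f ∧
      (∀ i j, i ≤ j → q i ∣ q j) ∧ (∀ i, q i ^ 2 ∣ N) ∧
      L = pairSpan (ZMod N) (fun i => (q i : ZMod N) • e' i)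
        (fun i => ((N / q i : ℕ) : ZMod N) • f' i) := by
  induction n generalizing L with
  | zero =>
    refine ⟨fun _ => 1, e, f, h, rfl, fun i => i.elim0, fun i => i.elim0, ?_⟩
    have hbot : ∀ e f : Fin 0 → V, pairSpan (ZMod N) e f = ⊥ := fun e f => by
      simp [pairSpan]
    rw [hbot] at hLW ⊢
    exact le_bot_iff.1 hLW
  | succ n ih =>
    obtain ⟨q, a, b, e₁, f₁, hq, haa, hbb, hab, h₁, ha, hb, hspan, haL, hbL, hdvd⟩ :=
      h.exists_splitting hN hodd hB hLW hL
    rw [← hspan] at hLW hL hdvd ⊢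
    have hqN : q ∣ N := (Dvd.intro_left (q ^ 1) (by ring)).trans hq
    obtain ⟨haW, hbW, hW⟩ := pairSpan_cons_le.1 (le_refl (pairSpan (ZMod N)
      (Fin.cons a e₁ : Fin (n + 1) → V) (Fin.cons b f₁ : Fin (n + 1) → V)))
    have hcons := h₁.cons hB haa hbb hab ha hb
    -- decomposition of vectors of `L` along the hyperbolic plane and its complement
    have hdec : ∀ w ∈ L, ∃ s t : ZMod N, ∃ y ∈ L ⊓ pairSpan (ZMod N) e₁ f₁,
        w = s • (q : ZMod N) • a + t • ((N / q : ℕ) : ZMod N) • b + y := by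
      intro w hw
      obtain ⟨s, hs⟩ := hdvd w hw b hbW
      obtain ⟨t, ht⟩ : ((N / q : ℕ) : ZMod N) ∣ B w a := by
        refine ZMod.natCast_div_dvd_of_mul_eq_zero hN hqN ?_
        simpa using (hL w (hLW hw)).1 hw _ haL
      have hsum := hcons.sum_eq hB (hLW hw)
      rw [Fin.sum_univ_succ] at hsum
      simp only [Fin.cons_zero, Fin.cons_succ] at hsum
      rw [hs, ht, mul_comm, mul_smul, mul_comm _ t, mul_smul] at hsum
      refine ⟨s, t, _, ⟨?_, ?_⟩, hsum.symm⟩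
      · rw [eq_sub_of_add_eq' hsum]
        exact sub_mem hw (add_mem (L.smul_mem _ haL) (L.smul_mem _ hbL))
      · exact sum_mem fun i _ => add_mem (Submodule.smul_mem _ _ (left_mem_pairSpan _))
          (Submodule.smul_mem _ _ (right_mem_pairSpan _))
    obtain ⟨q', e', f', h', hspan', hchain, hq', hL'⟩ := ih h₁
      (L := L ⊓ pairSpan (ZMod N) e₁ f₁) inf_le_right (by
        refine fun v hv => ⟨fun hvL w hw => (hL v (hW hv)).1 hvL.1 w hw.1, fun hvL => ⟨?_, hv⟩⟩
        refine (hL v (hW hv)).2 fun w hw => ?_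
        obtain ⟨s, t, y, hy, rfl⟩ := hdec w hw
        simp [hvL y hy, hB v a, hB v b, ha v hv, hb v hv])
    have hmem := pairSpan_le.1 hL'.ge
    have hdvd' : ∀ i, q ∣ q' i := fun i => by
      have hf : f' i ∈ pairSpan (ZMod N) e₁ f₁ := hspan' ▸ right_mem_pairSpan i
      have := hdvd _ (hmem.1 i).1 _ (hW hf)
      rwa [map_smul, LinearMap.smul_apply, h'.pairing, if_pos rfl, smul_eq_mul, mul_one,
        ZMod.natCast_dvd_natCast_iff_of_dvd hqN] at this
    refine ⟨Fin.cons q q', Fin.cons a e', Fin.cons b f', ?_, ?_, ?_, ?_, ?_⟩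
    · exact h'.cons hB haa hbb hab (hspan' ▸ ha) (hspan' ▸ hb)
    · refine le_antisymm (pairSpan_cons_le.2 ⟨haW, hbW, hspan'.le.trans hW⟩) ?_
      obtain ⟨haW', hbW', hW'⟩ := pairSpan_cons_le.1 (le_refl (pairSpan (ZMod N)
        (Fin.cons a e' : Fin (n + 1) → V) (Fin.cons b f' : Fin (n + 1) → V)))
      exact pairSpan_cons_le.2 ⟨haW', hbW', hspan'.ge.trans hW'⟩
    · intro i j hij
      induction i using Fin.cases with
      | zero =>
        induction j using Fin.cases with
        | zero => simp
        | succ j => simpa using hdvd' j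
      | succ i =>
        induction j using Fin.cases with
        | zero => exact absurd hij (by simp)
        | succ j => simpa using hchain i j (Fin.succ_le_succ_iff.1 hij)
    · exact Fin.cases (by simpa using hq) (by simpa using hq')
    · apply le_antisymm
      · intro w hw
        obtain ⟨s, t, y, hy, rfl⟩ := hdec w hw
        refine add_mem (add_mem (Submodule.smul_mem _ _ ?_) (Submodule.smul_mem _ _ ?_)) ?_
        · exact left_mem_pairSpan (R := ZMod N) (0 : Fin (n + 1))
        · exact right_mem_pairSpan (R := ZMod N) (0 : Fin (n + 1))
        · rw [hL'] at hy
          refine pairSpan_le.2 ⟨fun i => ?_, fun i => ?_⟩ hy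
          · exact left_mem_pairSpan (R := ZMod N) i.succ
          · exact right_mem_pairSpan (R := ZMod N) i.succ
      · refine pairSpan_le.2 ⟨Fin.cases haL fun i => (hmem.1 i).1,
          Fin.cases hbL fun i => (hmem.2 i).1⟩

/-- A submodule that is diagonal in a hyperbolic pair of families is Lagrangian. -/
theorem IsHyperbolic.mem_iff_of_adapted (hN : 0 < N) (hB : ∀ x y, B x y = B y x)
    {n : ℕ} {e f : Fin n → V} (h : IsHyperbolic B e f) {q : Fin n → ℕ} (hq : ∀ i, q i ∣ N)
    {v : V} (hv : v ∈ pairSpan (ZMod N) e f) :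
    v ∈ pairSpan (ZMod N) (fun i => (q i : ZMod N) • e i)
        (fun i => ((N / q i : ℕ) : ZMod N) • f i) ↔
      ∀ w ∈ pairSpan (ZMod N) (fun i => (q i : ZMod N) • e i)
        (fun i => ((N / q i : ℕ) : ZMod N) • f i), B v w = 0 := by
  refine ⟨fun hvL w hw => ?_, fun hvL => ?_⟩
  · have hzero : ∀ i j, i = j → ((N / q j : ℕ) : ZMod N) * (q i : ZMod N) = 0 := by
      rintro i _ rfl
      rw [mul_comm, ZMod.natCast_mul_natCast_div (hq i)]
    refine eq_zero_of_mem_pairSpan (fun i => ?_) (fun i => ?_) hw <;> rw [hB] <;>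
      refine eq_zero_of_mem_pairSpan (fun j => ?_) (fun j => ?_) hvL
    · simp [h.left]
    · simpa [h.pairing] using hzero i j
    · rw [hB]
      simpa [h.pairing] using hzero j i
    · simp [h.right]
  · rw [← h.sum_eq hB hv]
    refine sum_mem fun i _ => add_mem ?_ ?_
    · have := hvL _ (right_mem_pairSpan i)
      rw [map_smul, smul_eq_mul] at this
      have := ZMod.natCast_div_dvd_of_mul_eq_zero hN (Nat.div_dvd_of_dvd (hq i)) this
      rw [Nat.div_div_self (hq i) hN.ne'] at this
      obtain ⟨t, ht⟩ := this
      rw [ht, mul_comm, mul_smul]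
      exact Submodule.smul_mem _ _ (left_mem_pairSpan i)
    · have := hvL _ (left_mem_pairSpan i)
      rw [map_smul, smul_eq_mul] at this
      obtain ⟨t, ht⟩ := ZMod.natCast_div_dvd_of_mul_eq_zero hN (hq i) this
      rw [ht, mul_comm, mul_smul]
      exact Submodule.smul_mem _ _ (right_mem_pairSpan i)

end Adapted

section Coordinates

/-- The bilinear map underlying `adForm`. -/
def adBilin (N n : ℕ) : LinearMap.BilinForm (ZMod N) (Fin (2 * n) → ZMod N) :=
  LinearMap.mk₂ (ZMod N) (adForm N n)
    (fun x y z => by simp [adForm, add_mul, Finset.sum_add_distrib])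
    (fun c x y => by simp [adForm, Finset.mul_sum, mul_assoc])
    (fun x y z => by simp [adForm, mul_add, Finset.sum_add_distrib])
    (fun c x y => by simp [adForm, Finset.mul_sum, mul_left_comm])

variable {N n : ℕ}

theorem adBilin_apply (x y : Fin (2 * n) → ZMod N) : adBilin N n x y = adForm N n x y := rfl

theorem adBilin_comm (x y : Fin (2 * n) → ZMod N) : adBilin N n x y = adBilin N n y x := by
  simp only [adBilin_apply, adForm]
  rw [← Equiv.sum_comp Fin.revPerm]
  exact Finset.sum_congr rfl fun i _ => by simp [mul_comm]

theorem adMat_apply (i j : Fin (2 * n)) : adMat N n i j = if j = i.rev then 1 else 0 := by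
  rw [adMat, Matrix.of_apply]
  refine if_congr ?_ rfl rfl
  rw [Fin.ext_iff, Fin.val_rev]
  omega

theorem mul_adMat_mul_transpose_apply (P Q : Matrix (Fin (2 * n)) (Fin (2 * n)) (ZMod N))
    (i j : Fin (2 * n)) : (P * adMat N n * Qᵀ) i j = adBilin N n (P i) (Q j) := by
  have hrow : ∀ k, (P * adMat N n) i k = P i k.rev := fun k => by
    have : ∀ l : Fin (2 * n), k = l.rev ↔ l = k.rev := fun l => by rw [eq_comm, Fin.rev_eq_iff]
    simp [Matrix.mul_apply, adMat_apply, this]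
  simp only [Matrix.mul_apply (M := P * adMat N n), hrow, adBilin_apply, adForm,
    Matrix.transpose_apply]
  rw [← Equiv.sum_comp Fin.revPerm]
  simp

/-- The `i`-th index of the first half. -/
def lowIndex (i : Fin n) : Fin (2 * n) := ⟨i, by omega⟩

theorem exists_eq_lowIndex_or (i : Fin (2 * n)) :
    ∃ k : Fin n, i = lowIndex k ∨ i = (lowIndex k).rev := by
  by_cases h : i.1 < n
  · exact ⟨⟨i, h⟩, Or.inl rfl⟩
  · refine ⟨⟨2 * n - 1 - i, by omega⟩, Or.inr (Fin.ext ?_)⟩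
    simp only [lowIndex, Fin.val_rev]
    omega

theorem lowIndex_inj {i j : Fin n} : lowIndex i = lowIndex j ↔ i = j := by
  simp [lowIndex, Fin.ext_iff]

theorem lowIndex_ne_rev (i j : Fin n) : lowIndex i ≠ (lowIndex j).rev := by
  rw [Ne, Fin.ext_iff, Fin.val_rev]
  simp only [lowIndex]
  omega

theorem span_range_eq_pairSpan {R V : Type*} [CommRing R] [AddCommGroup V] [Module R V]
    (P : Fin (2 * n) → V) : Submodule.span R (Set.range P) =
      pairSpan R (fun i => P (lowIndex i)) (fun i => P (lowIndex i).rev) := by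
  apply le_antisymm
  · rw [Submodule.span_le]
    rintro _ ⟨i, rfl⟩
    obtain ⟨k, rfl | rfl⟩ := exists_eq_lowIndex_or i
    · exact left_mem_pairSpan k
    · exact right_mem_pairSpan k
  · exact pairSpan_le.2 ⟨fun i => Submodule.subset_span ⟨_, rfl⟩,
      fun i => Submodule.subset_span ⟨_, rfl⟩⟩

/-- A matrix preserves the antidiagonal form iff its rows form a hyperbolic pair of families. -/
theorem mul_adMat_mul_transpose_eq_iff (Q : Matrix (Fin (2 * n)) (Fin (2 * n)) (ZMod N)) :
    Q * adMat N n * Qᵀ = adMat N n ↔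
      IsHyperbolic (adBilin N n) (fun i => Q (lowIndex i)) (fun i => Q (lowIndex i).rev) := by
  constructor
  · intro h
    have hQ : ∀ i j, adBilin N n (Q i) (Q j) = if j = i.rev then 1 else 0 := fun i j => by
      rw [← mul_adMat_mul_transpose_apply, h, adMat_apply]
    refine ⟨fun i j => ?_, fun i j => ?_, fun i j => ?_⟩
    · rw [hQ, if_neg (lowIndex_ne_rev _ _)]
    · rw [hQ, Fin.rev_rev, if_neg (lowIndex_ne_rev _ _).symm]
    · simp [hQ, lowIndex_inj, eq_comm]
  · intro h
    ext i j
    rw [mul_adMat_mul_transpose_apply, adMat_apply]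
    obtain ⟨k, rfl | rfl⟩ := exists_eq_lowIndex_or i <;>
      obtain ⟨l, rfl | rfl⟩ := exists_eq_lowIndex_or j
    · rw [h.left, if_neg (lowIndex_ne_rev _ _)]
    · simp [h.pairing, lowIndex_inj, eq_comm]
    · rw [(h.swap adBilin_comm).pairing]
      simp [lowIndex_inj, eq_comm]
    · rw [h.right, Fin.rev_rev, if_neg (lowIndex_ne_rev _ _).symm]

theorem span_range_eq_top_of_mul_adMat_mul_transpose_eq
    {Q : Matrix (Fin (2 * n)) (Fin (2 * n)) (ZMod N)} (hQ : Q * adMat N n * Qᵀ = adMat N n) :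
    Submodule.span (ZMod N) (Set.range fun i => Q i) = ⊤ := by
  have hA : adMat N n * adMat N n = 1 := by
    ext i j
    simp only [Matrix.mul_apply, adMat_apply, Matrix.one_apply, ite_mul, one_mul, zero_mul,
      Finset.sum_ite_eq', Finset.mem_univ, if_true, Fin.rev_rev, eq_comm (a := j)]
  have hinv : (adMat N n * Qᵀ * adMat N n) * Q = 1 := by
    rw [mul_eq_one_comm, ← Matrix.mul_assoc, ← Matrix.mul_assoc, hQ, hA]
  rw [eq_top_iff]
  intro v _
  have hv : (v ᵥ* (adMat N n * Qᵀ * adMat N n)) ᵥ* Q = v := by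
    rw [Matrix.vecMul_vecMul, hinv, Matrix.vecMul_one]
  rw [← hv, Matrix.vecMul_eq_sum]
  exact sum_mem fun i _ => Submodule.smul_mem _ _ (Submodule.subset_span ⟨i, rfl⟩)

theorem span_range_diagonal_mul (q : Fin n → ℕ)
    (Q : Matrix (Fin (2 * n)) (Fin (2 * n)) (ZMod N)) :
    Submodule.span (ZMod N)
        (Set.range fun i : Fin (2 * n) =>
          (Matrix.diagonal (fun i : Fin (2 * n) =>
              if h : i.1 < n then ((q ⟨i.1, h⟩ : ℕ) : ZMod N)
              else ((N / q ⟨2 * n - 1 - i.1, by have := i.2; omega⟩ : ℕ) : ZMod N)) * Q) i) =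
      pairSpan (ZMod N) (fun i => (q i : ZMod N) • Q (lowIndex i))
        (fun i => ((N / q i : ℕ) : ZMod N) • Q (lowIndex i).rev) := by
  rw [span_range_eq_pairSpan]
  congr 1
  · ext i j
    simp [Matrix.diagonal_mul, lowIndex]
  · ext i j
    have hlt : ¬ 2 * n - (i.1 + 1) < n := by omega
    have hidx : 2 * n - 1 - (2 * n - (i.1 + 1)) = i.1 := by omega
    simp [Matrix.diagonal_mul, lowIndex, Fin.val_rev, hlt, hidx]

end Coordinates

/-- Classification of orthogonal Lagrangian submodules: for odd `N`, a submodule `L` of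
`(ZMod N)^{2n}` is Lagrangian with respect to the antidiagonal form iff it is the row
span of `diag(q₁, …, q_n, N/q_n, …, N/q₁) · Q` for a divisibility chain
`q₁ ∣ ⋯ ∣ q_n` with `q_n² ∣ N` and some `Q` orthogonal for the antidiagonal form. -/
theorem orthogonal_lagrangian_classification (N n : ℕ) (hN : 1 ≤ N) (hodd : Odd N)
    (hn : 1 ≤ n) (L : Submodule (ZMod N) (Fin (2 * n) → ZMod N)) :
    (∀ v, v ∈ L ↔ ∀ w ∈ L, adForm N n v w = 0) ↔
    ∃ (q : Fin n → ℕ) (Q : Matrix (Fin (2 * n)) (Fin (2 * n)) (ZMod N)),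
      (∀ i, 0 < q i) ∧
      (∀ i j : Fin n, i ≤ j → q i ∣ q j) ∧
      (q ⟨n - 1, by omega⟩) ^ 2 ∣ N ∧
      Q * adMat N n * Qᵀ = adMat N n ∧
      L = Submodule.span (ZMod N)
        (Set.range fun i : Fin (2 * n) =>
          (Matrix.diagonal (fun i : Fin (2 * n) =>
              if h : i.1 < n then ((q ⟨i.1, h⟩ : ℕ) : ZMod N)
              else ((N / q ⟨2 * n - 1 - i.1, by have := i.2; omega⟩ : ℕ) : ZMod N)) * Q) i) := by
  simp only [span_range_diagonal_mul]
  constructor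
  · intro hL
    have hone : (1 : Matrix (Fin (2 * n)) (Fin (2 * n)) (ZMod N)) * adMat N n * 1ᵀ = adMat N n := by
      simp
    have htop := span_range_eq_top_of_mul_adMat_mul_transpose_eq hone
    rw [span_range_eq_pairSpan] at htop
    obtain ⟨q, e, f, h, -, hchain, hq, hLq⟩ :=
      ((mul_adMat_mul_transpose_eq_iff _).1 hone).exists_adapted hN hodd adBilin_comm
        (htop ▸ le_top) (fun v _ => hL v)
    let Q : Matrix (Fin (2 * n)) (Fin (2 * n)) (ZMod N) := fun i =>
      if h : i.1 < n then e ⟨i.1, h⟩ else f ⟨2 * n - 1 - i.1, by have := i.2; omega⟩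
    have hQe : (fun i => Q (lowIndex i)) = e := by
      ext i : 1
      simp [Q, lowIndex]
    have hQf : (fun i => Q (lowIndex i).rev) = f := by
      ext i : 1
      have hlt : ¬ 2 * n - (i.1 + 1) < n := by omega
      have hidx : 2 * n - 1 - (2 * n - (i.1 + 1)) = i.1 := by omega
      simp [Q, lowIndex, Fin.val_rev, hlt, hidx]
    refine ⟨q, Q, fun i => ?_, hchain, hq _, ?_, ?_⟩
    · exact Nat.pos_of_ne_zero fun h0 => by
        have := hq i
        rw [h0] at this
        simp at this
        omega
    · rw [mul_adMat_mul_transpose_eq_iff, hQe, hQf]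
      exact h
    · rw [hLq]
      simp only [← hQe, ← hQf]
  · rintro ⟨q, Q, -, hchain, hq, hQ, rfl⟩ v
    have htop := span_range_eq_top_of_mul_adMat_mul_transpose_eq hQ
    rw [span_range_eq_pairSpan] at htop
    have hqN : ∀ i, q i ∣ N := fun i =>
      (hchain i _ (Fin.le_def.2 (Nat.le_sub_one_of_lt i.2))).trans
        ((dvd_pow_self _ two_ne_zero).trans hq)
    exact ((mul_adMat_mul_transpose_eq_iff Q).1 hQ).mem_iff_of_adapted hN adBilin_comm hqN
      (htop ▸ Submodule.mem_top)
end

section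
/- Let p be an odd prime and m ≥ 1. For 0 ≤ k ≤ ⌊m/2⌋ let L_k ⊆ (ZMod p^m)² be the submodule spanned by (p^k, p^k) and (0, p^{m−k}), and for ⌊m/2⌋ < k ≤ m let L_k be the submodule spanned by (p^{m−k}, −p^{m−k}) and (0, p^k). Then for all 0 ≤ i ≤ j ≤ m, the cardinality of L_i ∩ L_j equals p^{m − (j − i)}. -/
/-- The submodules `L_k` of `(ZMod p^m)²`: for `k ≤ ⌊m/2⌋`, the span of `(p^k, p^k)` and
`(0, p^{m−k})`; for `k > ⌊m/2⌋`, the span of `(p^{m−k}, −p^{m−k})` and `(0, p^k)`. -/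
def Lk (p m k : ℕ) : Submodule (ZMod (p ^ m)) (ZMod (p ^ m) × ZMod (p ^ m)) :=
  if k ≤ m / 2 then
    Submodule.span (ZMod (p ^ m))
      {((p : ZMod (p ^ m)) ^ k, (p : ZMod (p ^ m)) ^ k),
       (0, (p : ZMod (p ^ m)) ^ (m - k))}
  else
    Submodule.span (ZMod (p ^ m))
      {((p : ZMod (p ^ m)) ^ (m - k), -((p : ZMod (p ^ m)) ^ (m - k))),
       (0, (p : ZMod (p ^ m)) ^ k)}

theorem mem_span_diagonal_pair_iff {R : Type*} [CommRing R] (h2 : IsUnit (2 : R)) {a b : R}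
    (hab : a ∣ b) (z : R × R) :
    z ∈ Submodule.span R {(a, a), (0, b)} ↔ b ∣ z.1 - z.2 ∧ a ∣ z.1 + z.2 := by
  obtain ⟨h, hh⟩ := h2.exists_left_inv
  obtain ⟨e, rfl⟩ := hab
  obtain ⟨x, y⟩ := z
  simp only [Submodule.mem_span_pair, Prod.smul_mk, Prod.mk_add_mk, Prod.mk.injEq, smul_eq_mul]
  constructor
  · rintro ⟨s, t, rfl, rfl⟩
    exact ⟨⟨-t, by ring⟩, ⟨2 * s + t * e, by ring⟩⟩
  · rintro ⟨⟨c, hc⟩, ⟨d, hd⟩⟩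
    refine ⟨h * (e * c + d), -c, ?_, ?_⟩
    · linear_combination x * hh - h * hc - h * hd
    · linear_combination x * hh - h * hc - h * hd + hc

theorem mem_span_antidiagonal_pair_iff {R : Type*} [CommRing R] (h2 : IsUnit (2 : R)) {a b : R}
    (hab : a ∣ b) (z : R × R) :
    z ∈ Submodule.span R {(a, -a), (0, b)} ↔ a ∣ z.1 - z.2 ∧ b ∣ z.1 + z.2 := by
  obtain ⟨h, hh⟩ := h2.exists_left_inv
  obtain ⟨e, rfl⟩ := hab
  obtain ⟨x, y⟩ := z
  simp only [Submodule.mem_span_pair, Prod.smul_mk, Prod.mk_add_mk, Prod.mk.injEq, smul_eq_mul]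
  constructor
  · rintro ⟨s, t, rfl, rfl⟩
    exact ⟨⟨2 * s - t * e, by ring⟩, ⟨t, by ring⟩⟩
  · rintro ⟨⟨c, hc⟩, ⟨d, hd⟩⟩
    refine ⟨h * (e * d + c), d, ?_, ?_⟩
    · linear_combination x * hh - h * hc - h * hd
    · linear_combination -x * hh + h * hc + h * hd - hd

theorem mem_Lk_iff {p m k : ℕ} (h2 : IsUnit (2 : ZMod (p ^ m)))
    (z : ZMod (p ^ m) × ZMod (p ^ m)) :
    z ∈ Lk p m k ↔ (p : ZMod (p ^ m)) ^ (m - k) ∣ z.1 - z.2 ∧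
      (p : ZMod (p ^ m)) ^ k ∣ z.1 + z.2 := by
  unfold Lk
  split_ifs with h
  · exact mem_span_diagonal_pair_iff h2 (pow_dvd_pow _ (by omega)) z
  · exact mem_span_antidiagonal_pair_iff h2 (pow_dvd_pow _ (by omega)) z

/-- The change of coordinates `(x, y) ↦ (x - y, x + y)` when `2` is invertible. -/
def subAddEquiv {R : Type*} [CommRing R] (h : R) (hh : h * 2 = 1) : R × R ≃ R × R where
  toFun z := (z.1 - z.2, z.1 + z.2)
  invFun w := (h * (w.2 + w.1), h * (w.2 - w.1))
  left_inv z := by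
    ext
    · linear_combination z.1 * hh
    · linear_combination z.2 * hh
  right_inv w := by
    ext
    · linear_combination w.1 * hh
    · linear_combination w.2 * hh

theorem ZMod.card_pow_dvd {p m a : ℕ} (hp : p.Prime) (ha : a ≤ m) :
    Nat.card {x : ZMod (p ^ m) // (p : ZMod (p ^ m)) ^ a ∣ x} = p ^ (m - a) := by
  have hpm : p ^ m ≠ 0 := pow_ne_zero _ hp.ne_zero
  have hcard : Nat.card (AddSubgroup.zmultiples ((p ^ a : ℕ) : ZMod (p ^ m))) = p ^ (m - a) := by
    rw [Nat.card_zmultiples, ZMod.addOrderOf_coe _ hpm,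
      Nat.gcd_eq_right (pow_dvd_pow p ha), Nat.pow_div ha hp.pos]
  rw [← hcard]
  refine Nat.card_congr (Equiv.subtypeEquivRight fun x => ?_)
  rw [AddSubgroup.mem_zmultiples_iff]
  constructor
  · rintro ⟨c, rfl⟩
    obtain ⟨n, rfl⟩ := ZMod.intCast_surjective c
    exact ⟨n, by simp [mul_comm]⟩
  · rintro ⟨n, rfl⟩
    exact ⟨n, by simp [mul_comm]⟩

/-- For `0 ≤ i ≤ j ≤ m`, the cardinality of `L_i ∩ L_j` equals `p^{m − (j − i)}`. -/
theorem surface_operator_intersection_card (p m : ℕ) (hp : p.Prime) (hodd : Odd p)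
    (hm : 1 ≤ m) :
    ∀ i j : ℕ, i ≤ j → j ≤ m →
      Nat.card ↥(Lk p m i ⊓ Lk p m j) = p ^ (m - (j - i)) := by
  intro i j hij hjm
  have h2 : IsUnit (2 : ZMod (p ^ m)) := by
    have := (ZMod.isUnit_iff_coprime 2 (p ^ m)).2 (Nat.coprime_two_left.2 hodd.pow)
    exact_mod_cast this
  obtain ⟨h, hh⟩ := h2.exists_left_inv
  have hmem (z : ZMod (p ^ m) × ZMod (p ^ m)) : z ∈ Lk p m i ⊓ Lk p m j ↔
      (p : ZMod (p ^ m)) ^ (m - i) ∣ (subAddEquiv h hh z).1 ∧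
        (p : ZMod (p ^ m)) ^ j ∣ (subAddEquiv h hh z).2 := by
    rw [Submodule.mem_inf, mem_Lk_iff h2, mem_Lk_iff h2]
    exact ⟨fun H => ⟨H.1.1, H.2.2⟩, fun H =>
      ⟨⟨H.1, (pow_dvd_pow _ hij).trans H.2⟩, ⟨(pow_dvd_pow _ (by omega)).trans H.1, H.2⟩⟩⟩
  rw [Nat.card_congr (((subAddEquiv h hh).subtypeEquiv hmem).trans
      (Equiv.subtypeProdEquivProd (p := fun u => (p : ZMod (p ^ m)) ^ (m - i) ∣ u)
        (q := fun v => (p : ZMod (p ^ m)) ^ j ∣ v))),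
    Nat.card_prod, ZMod.card_pow_dvd hp (Nat.sub_le m i), ZMod.card_pow_dvd hp hjm, ← pow_add]
  congr 1
  omega
end
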